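/- arXiv:2009.10502 — 2 statements merged into one kernel-verified Lean document; each statement's English description precedes it below -/
import Mathlib

section
/- Let G be a simple graph and X a twin cover of G. Then every connected component of the subgraph of G induced on V(G) ∖ X is a clique; that is, if u and w are vertices outside X joined by a path all of whose vertices avoid X, then u = w or u and w are adjacent in G. -/
/-- Adjacent vertices `u`, `v` are true twins: they have the same closed
neighborhood `N[u] = N[v]`. -/
def TrueTwins {V : Type*} (G : SimpleGraph V) (u v : V) : Prop :=
  G.Adj u v ∧ ∀ w, w ≠ u → w ≠ v → (G.Adj u w ↔ G.Adj v w)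

/-- `X` is a twin cover of `G`: every edge has an endpoint in `X` or joins
true twins. -/
def IsTwinCover {V : Type*} (G : SimpleGraph V) (X : Set V) : Prop :=
  ∀ u v : V, G.Adj u v → u ∈ X ∨ v ∈ X ∨ TrueTwins G u v

/-- For a twin cover `X`, every connected component of `G[V ∖ X]` is a clique:
two vertices outside `X` joined by a walk avoiding `X` are equal or adjacent. -/
theorem twinCover_components_cliques {V : Type*} (G : SimpleGraph V) (X : Set V)
    (hX : IsTwinCover G X) :
    ∀ u w : V, u ∉ X → w ∉ X →
      (∃ W : G.Walk u w, ∀ x ∈ W.support, x ∉ X) → u = w ∨ G.Adj u w := by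
  rintro u w - - ⟨W, hW⟩
  induction W with
  | nil => exact Or.inl rfl
  | @cons u v w h p ih =>
    simp only [SimpleGraph.Walk.support_cons, List.mem_cons, forall_eq_or_imp] at hW
    obtain ⟨hu, hp⟩ := hW
    rcases ih hp with rfl | hvw
    · exact Or.inr h
    · rcases hX u v h with hu' | hv | ⟨-, ht⟩
      · exact absurd hu' hu
      · exact absurd hv (hp v p.start_mem_support)
      · by_cases huw : u = w
        · exact Or.inl huw
        · exact Or.inr ((ht w (Ne.symm huw) hvw.ne').2 hvw)
end

section
/- Let G be a connected finite simple graph and X a twin cover of G. If u and v are distinct vertices outside X with the same neighborhood inside X, i.e., N_G(u) ∩ X = N_G(v) ∩ X, then u and v are at distance at most 2 in G (they are adjacent or have a common neighbor). Consequently, in any L(p,1)-labeling of G, all vertices of a common type receive pairwise distinct labels. -/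
/-- `f` is an `L(p,1)`-labeling of `G`: labels of adjacent vertices differ by
at least `p`, and vertices at distance exactly 2 get distinct labels. -/
def IsLp1Labeling {V : Type*} (p : ℕ) (G : SimpleGraph V) (f : V → ℕ) : Prop :=
  (∀ u v : V, G.Adj u v → (p : ℤ) ≤ |(f u : ℤ) - (f v : ℤ)|) ∧
  (∀ u v : V, u ≠ v → ¬ G.Adj u v → (∃ w, G.Adj u w ∧ G.Adj w v) → f u ≠ f v)

/-- If no neighbor of `u ∉ X` lies in the twin cover `X`, then every vertex reachable from `u`
is `u` itself or a neighbor of `u`. -/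
theorem IsTwinCover.eq_or_adj_of_reachable {V : Type*} {G : SimpleGraph V} {X : Set V}
    (hX : IsTwinCover G X) {u w : V} (hu : u ∉ X) (hN : ∀ x ∈ X, ¬ G.Adj u x)
    (h : G.Reachable u w) : u = w ∨ G.Adj u w := by
  rw [SimpleGraph.reachable_iff_reflTransGen] at h
  induction h with
  | refl => exact Or.inl rfl
  | @tail y z _ hyz ih =>
    rcases ih with rfl | huy
    · exact Or.inr hyz
    · rcases hX u y huy with h | h | h
      · exact absurd h hu
      · exact absurd huy (hN y h)
      · by_cases hzu : u = z
        · exact Or.inl hzu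
        · exact Or.inr ((h.2 z (Ne.symm hzu) hyz.ne').2 hyz)

/-- In a connected graph with twin cover `X`, two distinct vertices outside `X`
of the same type (same neighborhood inside `X`) are at distance at most 2;
consequently vertices of a common type get pairwise distinct labels in any
`L(p,1)`-labeling. -/
theorem same_type_dist_le_two {V : Type*} [Fintype V] (G : SimpleGraph V)
    (X : Set V) (hcon : G.Connected) (hX : IsTwinCover G X) (u v : V)
    (hu : u ∉ X) (hv : v ∉ X) (huv : u ≠ v)
    (hN : G.neighborSet u ∩ X = G.neighborSet v ∩ X) :
    (G.Adj u v ∨ ∃ w, G.Adj u w ∧ G.Adj w v) ∧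
    ∀ p : ℕ, 1 ≤ p → ∀ f : V → ℕ, IsLp1Labeling p G f → f u ≠ f v := by
  have hdist : G.Adj u v ∨ ∃ w, G.Adj u w ∧ G.Adj w v := by
    by_cases hx : ∃ x ∈ X, G.Adj u x
    · obtain ⟨x, hxX, hux⟩ := hx
      have hvx : x ∈ G.neighborSet v ∩ X := hN ▸ ⟨hux, hxX⟩
      exact Or.inr ⟨x, hux, SimpleGraph.Adj.symm hvx.1⟩
    · push Not at hx
      exact Or.inl ((hX.eq_or_adj_of_reachable hu hx (hcon.preconnected u v)).resolve_left huv)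
  refine ⟨hdist, fun p hp f hf heq => ?_⟩
  by_cases hadj : G.Adj u v
  · have h := hf.1 u v hadj
    rw [heq, sub_self, abs_zero] at h
    omega
  · exact hf.2 u v huv hadj (hdist.resolve_left hadj) heq
end
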